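/- (Nonempty second-Melnikov resonant sets force ||j|^{3/2} − |j'|^{3/2}| ≲ ⟨ℓ⟩.) There exist ε₀ ∈ (0,1) and C > 0, depending only on 𝚑, g, γ, κ₁, κ₂, the tangential sites, C₀ and τ, such that if ε ≤ υ ≤ ε₀, then for every ℓ ∈ ℤ^ν and j, j' ∈ S₀ᶜ with j⃗·ℓ + j − j' = 0 the following holds: if there exists κ ∈ [κ₁, κ₂] with |ω⃗_ε(κ)·ℓ + μ_j(κ) − μ_{j'}(κ)| < 4υ·⟨|j|^{3/2} − |j'|^{3/2}⟩·⟨ℓ⟩^{−τ}, then ||j|^{3/2} − |j'|^{3/2}| ≤ C·⟨ℓ⟩. -/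

import Mathlib

open Real Finset Set

/-- `G_j := j · tanh(dpt · j)` (finite depth `dpt`). -/
noncomputable def Gfun (dpt : ℝ) (j : ℤ) : ℝ := (j : ℝ) * Real.tanh (dpt * (j : ℝ))

/-- The linear frequencies `ω_j(κ)`. -/
noncomputable def omegaF (dpt g γ : ℝ) (j : ℤ) (κ : ℝ) : ℝ :=
  Real.sqrt (κ * Gfun dpt j * (j : ℝ) ^ 2 + g * Gfun dpt j + (γ * Gfun dpt j / (2 * (j : ℝ))) ^ 2)

/-- The linear frequencies `Ω_j(κ) = ω_j(κ) + (γ/2) G_j / j`. -/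
noncomputable def OmegaF (dpt g γ : ℝ) (j : ℤ) (κ : ℝ) : ℝ :=
  omegaF dpt g γ j κ + γ / 2 * Gfun dpt j / (j : ℝ)

/-- The perturbed frequencies μ_j(κ). -/
noncomputable def muF (dpt g γ : ℝ) (m32 m1 m12 : ℝ → ℝ) (r : ℤ → ℝ → ℝ) (j : ℤ) (κ : ℝ) : ℝ :=
  m32 κ * OmegaF dpt g γ j κ + m1 κ * (j : ℝ) + m12 κ * |(j : ℝ)| ^ ((1 : ℝ) / 2) + r j κ
theorem one_sub_tanh_le_one_div_sq {x : ℝ} (hx : 0 < x) : 1 - Real.tanh x ≤ 1 / x ^ 2 := by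
  have hc : 0 < Real.cosh x := Real.cosh_pos x
  have he : (1 - Real.tanh x) * Real.cosh x = Real.exp (-x) := by
    rw [Real.tanh_eq_sinh_div_cosh, sub_mul, div_mul_cancel₀ _ hc.ne', one_mul, Real.cosh_sub_sinh]
  have hq : 1 + x + x ^ 2 / 2 ≤ Real.exp x := Real.quadratic_le_exp_of_nonneg hx.le
  have hcosh : Real.exp x ≤ 2 * Real.cosh x := by
    rw [Real.cosh_eq]; linarith [Real.exp_pos (-x)]
  have hprod : Real.exp (-x) * Real.exp x = 1 := by rw [← Real.exp_add]; simp
  have hexp : x ^ 2 ≤ Real.cosh x * Real.exp x := by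
    nlinarith [mul_pos hx hx, pow_pos hx 3, mul_self_le_mul_self (by positivity) hq]
  rw [le_div_iff₀ (by positivity)]
  refine le_of_mul_le_mul_right ?_ hc
  have : (1 - Real.tanh x) * x ^ 2 * Real.cosh x = Real.exp (-x) * x ^ 2 := by rw [← he]; ring
  rw [this]
  calc Real.exp (-x) * x ^ 2 ≤ Real.exp (-x) * (Real.cosh x * Real.exp x) := by gcongr
    _ = (Real.exp (-x) * Real.exp x) * Real.cosh x := by ring
    _ = 1 * Real.cosh x := by rw [hprod]

theorem Gfun_eq_abs_mul_tanh (dpt : ℝ) (j : ℤ) :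
    Gfun dpt j = |(j : ℝ)| * Real.tanh (dpt * |(j : ℝ)|) := by
  unfold Gfun
  rcases abs_choice (j : ℝ) with h | h <;> rw [h]
  rw [mul_neg, Real.tanh_neg, neg_mul_neg]

theorem one_le_abs_intCast {j : ℤ} (hj : j ≠ 0) : 1 ≤ |(j : ℝ)| := by
  exact_mod_cast Int.one_le_abs hj

theorem rpow_three_halves_sq {x : ℝ} (hx : 0 ≤ x) : (x ^ ((3 : ℝ) / 2)) ^ 2 = x ^ 3 := by
  rw [← Real.rpow_natCast, ← Real.rpow_mul hx, ← Real.rpow_natCast]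
  norm_num

theorem abs_Gfun_div_le_one (dpt : ℝ) {j : ℤ} (hj : j ≠ 0) : |Gfun dpt j / j| ≤ 1 := by
  have hj' : (j : ℝ) ≠ 0 := by exact_mod_cast hj
  rw [Gfun, mul_div_cancel_left₀ _ hj']
  exact (Real.abs_tanh_lt_one _).le

/-- `ω_j(κ)² = κ |j|³ + O(|j|)`. -/
theorem abs_omegaF_sq_sub_le {dpt g κ : ℝ} (γ : ℝ) (hdpt : 0 < dpt) (hg : 0 < g) (hκ : 0 < κ)
    {j : ℤ} (hj : j ≠ 0) :
    |omegaF dpt g γ j κ ^ 2 - κ * |(j : ℝ)| ^ 3|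
      ≤ (κ / dpt ^ 2 + g + γ ^ 2 / 4) * |(j : ℝ)| := by
  have hsq : |Gfun dpt j / j| ^ 2 ≤ 1 := pow_le_one₀ (abs_nonneg _) (abs_Gfun_div_le_one dpt hj)
  rw [sq_abs] at hsq
  have hγ : (γ * Gfun dpt j / (2 * (j : ℝ))) ^ 2 = γ ^ 2 / 4 * (Gfun dpt j / j) ^ 2 := by ring
  have hx := one_le_abs_intCast hj
  have hG := Gfun_eq_abs_mul_tanh dpt j
  have hjsq : (j : ℝ) ^ 2 = |(j : ℝ)| ^ 2 := (sq_abs _).symm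
  set x := |(j : ℝ)|
  set t := Real.tanh (dpt * x)
  have hx0 : 0 < x := by linarith
  have ht1 : t < 1 := Real.tanh_lt_one _
  have ht0 : 0 ≤ t := by
    simp only [t]
    rw [Real.tanh_eq_sinh_div_cosh]
    exact div_nonneg (Real.sinh_nonneg_iff.mpr (by positivity)) (Real.cosh_pos _).le
  have ht : 1 - t ≤ 1 / (dpt * x) ^ 2 := one_sub_tanh_le_one_div_sq (by positivity)
  have hlead : κ * x ^ 3 * (1 - t) ≤ κ / dpt ^ 2 * x := by
    calc κ * x ^ 3 * (1 - t) ≤ κ * x ^ 3 * (1 / (dpt * x) ^ 2) := by gcongr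
      _ = κ / dpt ^ 2 * x := by field_simp
  have hlead0 : 0 ≤ κ * x ^ 3 * (1 - t) := by
    have : 0 ≤ 1 - t := by linarith
    positivity
  have hgr : g * (x * t) ≤ g * x := by
    have : x * t ≤ x * 1 := by gcongr
    nlinarith
  have hvort : γ ^ 2 / 4 * (Gfun dpt j / j) ^ 2 ≤ γ ^ 2 / 4 * x := by
    gcongr; linarith
  have hvort0 : 0 ≤ γ ^ 2 / 4 * (Gfun dpt j / j) ^ 2 := by positivity
  have hgr0 : 0 ≤ g * (x * t) := by positivity
  have hκd : 0 ≤ κ / dpt ^ 2 * x := by positivity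
  have hγx : 0 ≤ γ ^ 2 / 4 * x := by positivity
  have hgx : 0 ≤ g * x := by positivity
  have harg : 0 ≤ κ * Gfun dpt j * (j : ℝ) ^ 2 + g * Gfun dpt j
      + (γ * Gfun dpt j / (2 * (j : ℝ))) ^ 2 := by
    rw [hG]; positivity
  rw [omegaF, Real.sq_sqrt harg, hγ, hjsq]
  generalize γ ^ 2 / 4 * (Gfun dpt j / j) ^ 2 = v at *
  rw [hG, abs_le]
  constructor <;> nlinarith

/-- The linear frequencies grow like `√κ |j|^(3/2)`, with a uniformly bounded remainder. -/
theorem abs_OmegaF_sub_le {dpt g κ₁ κ₂ κ : ℝ} (γ : ℝ) (hdpt : 0 < dpt) (hg : 0 < g)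
    (hκ₁ : 0 < κ₁) (hκ : κ ∈ Set.Icc κ₁ κ₂) {j : ℤ} (hj : j ≠ 0) :
    |OmegaF dpt g γ j κ - Real.sqrt κ * |(j : ℝ)| ^ ((3 : ℝ) / 2)|
      ≤ (κ₂ / dpt ^ 2 + g + γ ^ 2 / 4) / Real.sqrt κ₁ + |γ| / 2 := by
  have hκ0 : 0 < κ := hκ₁.trans_le hκ.1
  have hx := one_le_abs_intCast hj
  have hω := abs_omegaF_sq_sub_le γ hdpt hg hκ0 hj
  have hX2 := rpow_three_halves_sq (abs_nonneg (j : ℝ))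
  have hX : |(j : ℝ)| ≤ |(j : ℝ)| ^ ((3 : ℝ) / 2) :=
    Real.self_le_rpow_of_one_le hx (by norm_num)
  have hω0 : 0 ≤ omegaF dpt g γ j κ := Real.sqrt_nonneg _
  have hs : Real.sqrt κ₁ ≤ Real.sqrt κ := Real.sqrt_le_sqrt hκ.1
  have hs0 : 0 < Real.sqrt κ₁ := Real.sqrt_pos.mpr hκ₁
  have hsq : Real.sqrt κ ^ 2 = κ := Real.sq_sqrt hκ0.le
  have hvort : |γ / 2 * Gfun dpt j / (j : ℝ)| ≤ |γ| / 2 := by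
    rw [mul_div_assoc, abs_mul, abs_div, abs_two]
    exact mul_le_of_le_one_right (by positivity) (abs_Gfun_div_le_one dpt hj)
  unfold OmegaF
  generalize omegaF dpt g γ j κ = w at *
  generalize |(j : ℝ)| ^ ((3 : ℝ) / 2) = X at *
  set x := |(j : ℝ)|
  have hx0 : 0 < x := by linarith
  have hmain : |w - Real.sqrt κ * X| ≤ (κ₂ / dpt ^ 2 + g + γ ^ 2 / 4) / Real.sqrt κ₁ := by
    rw [le_div_iff₀ hs0]
    refine le_of_mul_le_mul_right ?_ hx0
    calc |w - Real.sqrt κ * X| * Real.sqrt κ₁ * x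
        ≤ |w - Real.sqrt κ * X| * (w + Real.sqrt κ * X) := by
          rw [mul_assoc]
          gcongr
          have : Real.sqrt κ₁ * x ≤ Real.sqrt κ * X := by gcongr
          linarith
      _ = |w ^ 2 - κ * x ^ 3| := by
          have hpos : 0 ≤ w + Real.sqrt κ * X := by
            have := hx0.le.trans hX
            positivity
          conv_lhs => rw [← abs_of_nonneg hpos]
          rw [← abs_mul, ← hX2]
          nth_rewrite 3 [← hsq]
          congr 1
          ring
      _ ≤ (κ / dpt ^ 2 + g + γ ^ 2 / 4) * x := hω
      _ ≤ (κ₂ / dpt ^ 2 + g + γ ^ 2 / 4) * x := by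
          gcongr
          exact hκ.2
  calc |w + γ / 2 * Gfun dpt j / (j : ℝ) - Real.sqrt κ * X|
      = |(w - Real.sqrt κ * X) + γ / 2 * Gfun dpt j / (j : ℝ)| := by ring_nf
    _ ≤ _ := (abs_add_le _ _).trans (add_le_add hmain hvort)

theorem abs_rpow_half_sub_le {x y : ℝ} (hx : 1 ≤ x) (hy : 1 ≤ y) :
    |x ^ ((1 : ℝ) / 2) - y ^ ((1 : ℝ) / 2)| ≤ |x - y| := by
  rw [← Real.sqrt_eq_rpow, ← Real.sqrt_eq_rpow]
  have hsx : 1 ≤ Real.sqrt x := Real.one_le_sqrt.mpr hx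
  have hsy : 1 ≤ Real.sqrt y := Real.one_le_sqrt.mpr hy
  have hfac : x - y = (Real.sqrt x - Real.sqrt y) * (Real.sqrt x + Real.sqrt y) := by
    nlinarith [Real.sq_sqrt (zero_le_one.trans hx), Real.sq_sqrt (zero_le_one.trans hy)]
  rw [hfac, abs_mul]
  refine le_mul_of_one_le_right (abs_nonneg _) ?_
  rw [abs_of_nonneg (by positivity)]
  linarith

theorem abs_sum_intCast_mul_le {n : ℕ} (ℓ : Fin n → ℤ) {w b : Fin n → ℝ}
    (hw : ∀ a, |w a| ≤ b a) : |∑ a, (ℓ a : ℝ) * w a| ≤ (∑ a, b a) * max 1 ‖ℓ‖ := by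
  rw [Finset.sum_mul]
  refine (Finset.abs_sum_le_sum_abs _ _).trans (Finset.sum_le_sum fun a _ => ?_)
  have hℓ : |(ℓ a : ℝ)| ≤ max 1 ‖ℓ‖ := by
    rw [← Int.norm_eq_abs]
    exact (norm_le_pi_norm ℓ a).trans (le_max_right _ _)
  rw [abs_mul, mul_comm]
  exact mul_le_mul (hw a) hℓ (abs_nonneg _) ((abs_nonneg _).trans (hw a))

/-- Nonempty second-Melnikov resonant sets force ||j|^(3/2) − |j'|^(3/2)| ≲ ⟨ℓ⟩. -/
theorem resonant_set_II_nonempty_restriction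
    (dpt g γ κ₁ κ₂ : ℝ) (hdpt : 0 < dpt) (hg : 0 < g) (hκ₁ : 0 < κ₁) (hκ₁₂ : κ₁ < κ₂)
    (ν : ℕ) (hν : 1 ≤ ν) (jbar : Fin ν → ℤ)
    (hjne : ∀ a, jbar a ≠ 0)
    (hjinj : Function.Injective fun a => |jbar a|)
    (C₀ τ : ℝ) (hC₀ : 0 < C₀) (hτ : 1 ≤ τ) :
    ∃ ε₀ ∈ Set.Ioo (0 : ℝ) 1, ∃ C > (0 : ℝ),
      ∀ ε υ : ℝ, 0 < ε → ε ≤ υ → υ ≤ ε₀ →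
      ∀ (m32 m1 m12 : ℝ → ℝ) (r : ℤ → ℝ → ℝ) (ωε : ℝ → Fin ν → ℝ),
        (∀ κ ∈ Set.Icc κ₁ κ₂,
          |m32 κ - 1| ≤ C₀ * ε ∧ |m1 κ| ≤ C₀ * ε ∧ |m12 κ| ≤ C₀ * ε ∧
          (∀ j : ℤ, j ≠ 0 → (∀ a, j ≠ jbar a) → |r j κ| ≤ C₀ * ε / υ) ∧
          ‖(fun a => ωε κ a - OmegaF dpt g γ (jbar a) κ)‖ ≤ C₀ * ε / υ) →
      ∀ (ℓ : Fin ν → ℤ) (j j' : ℤ),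
        j ≠ 0 → (∀ a, j ≠ jbar a) → j' ≠ 0 → (∀ a, j' ≠ jbar a) →
        (∑ a, jbar a * ℓ a) + j - j' = 0 →
        (∃ κ ∈ Set.Icc κ₁ κ₂,
          |(∑ a, (ℓ a : ℝ) * ωε κ a) + muF dpt g γ m32 m1 m12 r j κ
              - muF dpt g γ m32 m1 m12 r j' κ| <
            4 * υ * max 1 |(|(j : ℝ)| ^ ((3 : ℝ) / 2) - |(j' : ℝ)| ^ ((3 : ℝ) / 2))|
              * (max 1 ‖ℓ‖) ^ (-τ)) →
        |(|(j : ℝ)| ^ ((3 : ℝ) / 2) - |(j' : ℝ)| ^ ((3 : ℝ) / 2))| ≤ C * max 1 ‖ℓ‖ := by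
  have hs0 : 0 < Real.sqrt κ₁ := Real.sqrt_pos.mpr hκ₁
  have hκ₂ : 0 < κ₂ := hκ₁.trans hκ₁₂
  set s := Real.sqrt κ₁
  set K := (κ₂ / dpt ^ 2 + g + γ ^ 2 / 4) / s + |γ| / 2
  have hK0 : 0 ≤ K := by positivity
  set M := ∑ a, (C₀ + (Real.sqrt κ₂ * |(jbar a : ℝ)| ^ ((3 : ℝ) / 2) + K))
  have hM0 : 0 ≤ M := Finset.sum_nonneg fun a _ => by positivity
  set J := ∑ a, |(jbar a : ℝ)|
  have hJ0 : 0 ≤ J := Finset.sum_nonneg fun a _ => abs_nonneg _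
  refine ⟨min (1 / 2) (min (1 / (2 * C₀)) (s / 16)),
    ⟨by positivity, (min_le_left _ _).trans_lt (by norm_num)⟩,
    4 / s * (M + 2 * C₀ * J + 2 * C₀ + K + 4), by positivity, ?_⟩
  intro ε υ hε hευ hυ m32 m1 m12 r ωε hbound ℓ j j' hj hjS hj' hjS' hmom ⟨κ, hκ, hres⟩
  obtain ⟨hm32, hm1, hm12, hr, hω⟩ := hbound κ hκ
  have hυ0 : 0 < υ := hε.trans_le hευ
  have hυ1 : υ ≤ 1 / 2 := hυ.trans (min_le_left _ _)
  have hυC : C₀ * υ ≤ 1 / 2 := by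
    have h : υ ≤ 1 / (2 * C₀) := hυ.trans ((min_le_right _ _).trans (min_le_left _ _))
    rw [le_div_iff₀ (by positivity)] at h
    linarith
  have hυs : υ ≤ s / 16 := hυ.trans ((min_le_right _ _).trans (min_le_right _ _))
  have hC₀ε : C₀ * ε ≤ 1 / 2 := (mul_le_mul_of_nonneg_left hευ hC₀.le).trans hυC
  have hC₀ε' : C₀ * ε ≤ C₀ := mul_le_of_le_one_right hC₀.le (by linarith)
  have hquot : C₀ * ε / υ ≤ C₀ := by
    rw [div_le_iff₀ hυ0]
    exact mul_le_mul_of_nonneg_left hευ hC₀.le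
  have hL1 : 1 ≤ max 1 ‖ℓ‖ := le_max_left _ _
  have hΩ {i : ℤ} (hi : i ≠ 0) :
      |OmegaF dpt g γ i κ - Real.sqrt κ * |(i : ℝ)| ^ ((3 : ℝ) / 2)| ≤ K :=
    abs_OmegaF_sub_le γ hdpt hg hκ₁ hκ hi
  have hωsum : |∑ a, (ℓ a : ℝ) * ωε κ a| ≤ M * max 1 ‖ℓ‖ := by
    refine abs_sum_intCast_mul_le ℓ fun a => ?_
    have h1 : |ωε κ a - OmegaF dpt g γ (jbar a) κ| ≤ C₀ :=
      (norm_le_pi_norm (fun a => ωε κ a - OmegaF dpt g γ (jbar a) κ) a).trans (hω.trans hquot)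
    have h2 := hΩ (hjne a)
    have h3 : Real.sqrt κ * |(jbar a : ℝ)| ^ ((3 : ℝ) / 2)
        ≤ Real.sqrt κ₂ * |(jbar a : ℝ)| ^ ((3 : ℝ) / 2) := by
      gcongr
      exact hκ.2
    have h4 : 0 ≤ Real.sqrt κ * |(jbar a : ℝ)| ^ ((3 : ℝ) / 2) := by positivity
    rw [abs_le] at h1 h2 ⊢
    constructor <;> linarith
  have hdiff : |(j : ℝ) - j'| ≤ J * max 1 ‖ℓ‖ := by
    have h : (j : ℝ) - j' = -∑ a, (ℓ a : ℝ) * (jbar a : ℝ) := by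
      have h : ((∑ a, jbar a * ℓ a : ℤ) : ℝ) + j - j' = 0 := by exact_mod_cast hmom
      push_cast at h
      simp only [mul_comm (ℓ _ : ℝ)]
      linarith
    rw [h, abs_neg]
    exact abs_sum_intCast_mul_le ℓ fun a => le_rfl
  have htransport : |m1 κ * ((j : ℝ) - j')| ≤ C₀ * (J * max 1 ‖ℓ‖) := by
    rw [abs_mul]
    exact mul_le_mul (hm1.trans hC₀ε') hdiff (abs_nonneg _) hC₀.le
  have hhalf : |m12 κ * (|(j : ℝ)| ^ ((1 : ℝ) / 2) - |(j' : ℝ)| ^ ((1 : ℝ) / 2))|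
      ≤ C₀ * (J * max 1 ‖ℓ‖) := by
    rw [abs_mul]
    refine mul_le_mul (hm12.trans hC₀ε') ?_ (abs_nonneg _) hC₀.le
    exact (abs_rpow_half_sub_le (one_le_abs_intCast hj) (one_le_abs_intCast hj')).trans
      ((abs_abs_sub_abs_le _ _).trans hdiff)
  have hrj := (hr j hj hjS).trans hquot
  have hrj' := (hr j' hj' hjS').trans hquot
  have hΩj := hΩ hj
  have hΩj' := hΩ hj'
  have hLτ : max 1 ‖ℓ‖ ^ (-τ) ≤ 1 :=
    Real.rpow_le_one_of_one_le_of_nonpos hL1 (by linarith)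
  have hsκ : s ≤ Real.sqrt κ := Real.sqrt_le_sqrt hκ.1
  unfold muF at hres
  clear_value M J K s
  generalize |(j : ℝ)| ^ ((3 : ℝ) / 2) = X at *
  generalize |(j' : ℝ)| ^ ((3 : ℝ) / 2) = X' at *
  generalize OmegaF dpt g γ j κ = Ωj at *
  generalize OmegaF dpt g γ j' κ = Ωj' at *
  have hupper : |m32 κ * (Ωj - Ωj')| ≤
      (M + 2 * C₀ * J) * max 1 ‖ℓ‖ + 2 * C₀ + 4 * υ * (1 + |X - X'|) := by
    have hres' : 4 * υ * max 1 |X - X'| * max 1 ‖ℓ‖ ^ (-τ) ≤ 4 * υ * (1 + |X - X'|) := by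
      refine (mul_le_of_le_one_right (by positivity) hLτ).trans ?_
      gcongr
      exact max_le (by linarith [abs_nonneg (X - X')]) (by linarith)
    have h := hres.trans_le hres'
    rw [abs_lt] at h
    rw [abs_le] at hωsum htransport hhalf hrj hrj' ⊢
    constructor <;> linarith
  have hlower : (s * |X - X'| - 2 * K) / 2 ≤ |m32 κ * (Ωj - Ωj')| := by
    have h1 : s * |X - X'| ≤ |Ωj - Ωj'| + 2 * K := by
      calc s * |X - X'| ≤ Real.sqrt κ * |X - X'| := by gcongr
        _ = |Real.sqrt κ * X - Real.sqrt κ * X'| := by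
            rw [← mul_sub, abs_mul, abs_of_nonneg (Real.sqrt_nonneg κ)]
        _ = |(Ωj - Ωj') - (Ωj - Real.sqrt κ * X) + (Ωj' - Real.sqrt κ * X')| := by ring_nf
        _ ≤ |Ωj - Ωj'| + |Ωj - Real.sqrt κ * X| + |Ωj' - Real.sqrt κ * X'| :=
            (abs_add_le _ _).trans (add_le_add (abs_sub _ _) le_rfl)
        _ ≤ |Ωj - Ωj'| + 2 * K := by linarith
    have h2 : 1 / 2 ≤ |m32 κ| := by
      have := (abs_le.mp hm32).1
      exact le_trans (by linarith) (le_abs_self _)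
    have h3 := mul_le_mul_of_nonneg_right h2 (abs_nonneg (Ωj - Ωj'))
    rw [abs_mul]
    linarith
  have hsmall : 4 * υ * (1 + |X - X'|) ≤ 2 + s / 4 * |X - X'| := by
    have h := mul_le_mul_of_nonneg_right hυs (abs_nonneg (X - X'))
    linarith
  have habsorb : s / 4 * |X - X'| ≤ (M + 2 * C₀ * J + 2 * C₀ + K + 4) * max 1 ‖ℓ‖ := by
    have h : 2 * C₀ + K + 4 ≤ (2 * C₀ + K + 4) * max 1 ‖ℓ‖ :=
      le_mul_of_one_le_right (by positivity) hL1
    linarith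
  calc |X - X'| = 4 / s * (s / 4 * |X - X'|) := by field_simp
    _ ≤ 4 / s * ((M + 2 * C₀ * J + 2 * C₀ + K + 4) * max 1 ‖ℓ‖) := by gcongr
    _ = _ := by ring
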